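/- There exists a constant C : ℕ such that for every k ≥ 2 and every k-CNF formula φ over n variables with m clauses, there exists a monotone k-CNF formula φ' over at most C·(n + n·m·(n+2)) variables such that #φ = #φ' mod 2^(n+1) (i.e., #φ equals the remainder of #φ' upon division by 2^(n+1), since #φ ≤ 2^n). -/

import Mathlib

/-- A CNF formula over `n` variables: a list of clauses, each a finite set of
literals `(i, b)` where `b = true` means the positive literal `xᵢ` and
`b = false` means the negated literal `¬xᵢ`. -/
abbrev CNF (n : ℕ) := List (Finset (Fin n × Bool))

/-- An assignment satisfies a CNF formula if every clause has a true literal. -/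
def CNF.Sat {n : ℕ} (x : Fin n → Bool) (φ : CNF n) : Prop :=
  ∀ c ∈ φ, ∃ l ∈ c, x l.1 = l.2

/-- The number of satisfying assignments `#φ`. -/
noncomputable def CNF.count {n : ℕ} (φ : CNF n) : ℕ :=
  Nat.card {x : Fin n → Bool // CNF.Sat x φ}

/-- A `k`-CNF: every clause has at most `k` literals. -/
def CNF.IsKCNF {n : ℕ} (k : ℕ) (φ : CNF n) : Prop :=
  ∀ c ∈ φ, c.card ≤ k

/-- A monotone CNF: no negated literals. -/
def CNF.Monotone' {n : ℕ} (φ : CNF n) : Prop :=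
  ∀ c ∈ φ, ∀ l ∈ c, l.2 = true

/-- The primal graph: two distinct variables are adjacent iff they occur
together in some clause. -/
def CNF.primalGraph {n : ℕ} (φ : CNF n) : SimpleGraph (Fin n) :=
  SimpleGraph.fromRel (fun i j => ∃ c ∈ φ, (∃ b, (i, b) ∈ c) ∧ (∃ b, (j, b) ∈ c))

/-- The number of clauses in which variable `i` occurs. -/
def CNF.varDegree {n : ℕ} (φ : CNF n) (i : Fin n) : ℕ :=
  φ.countP (fun c => decide (∃ b, (i, b) ∈ c))

/-- An assignment satisfies an XSAT instance if every clause has exactly one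
true literal. -/
def XSat {n : ℕ} (x : Fin n → Bool) (f : CNF n) : Prop :=
  ∀ c ∈ f, (c.filter (fun l => x l.1 = l.2)).card = 1

/-- The number of satisfying assignments of an XSAT instance. -/
noncomputable def xcount {n : ℕ} (f : CNF n) : ℕ :=
  Nat.card {x : Fin n → Bool // XSat x f}

/-- Total number of literal occurrences. -/
def CNF.size {n : ℕ} (f : CNF n) : ℕ := (f.map Finset.card).sum

/-- The number of perfect matchings of a graph. -/
noncomputable def perfMatch {V : Type*} (G : SimpleGraph V) : ℕ :=
  Nat.card {M : G.Subgraph // M.IsPerfectMatching}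


/-- The number of pairs `(p, z)` with `A p`, where the bits `z i j` are free if `R p i` and forced to
be true otherwise, is congruent modulo `2 ^ N` to the number of `p` leaving no bit free. -/
theorem card_forcedBits_modEq {P ι : Type*} [Fintype P] [Fintype ι] (N : ℕ) (A : P → Prop)
    (R : P → ι → Prop) :
    Nat.card {q : P × (ι → Fin N → Bool) // A q.1 ∧ ∀ i j, R q.1 i ∨ q.2 i j = true} ≡
      Nat.card {p : P // A p ∧ ∀ i, ¬ R p i} [MOD 2 ^ N] := by
  classical
  have fiber (p : P) :
      Nat.card {z : ι → Fin N → Bool // A p ∧ ∀ i j, R p i ∨ z i j = true} ≡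
        (if A p ∧ ∀ i, ¬ R p i then 1 else 0) [MOD 2 ^ N] := by
    by_cases hA : A p
    · by_cases hR : ∀ i, ¬ R p i
      · rw [if_pos ⟨hA, hR⟩]
        have : Nat.card {z : ι → Fin N → Bool // A p ∧ ∀ i j, R p i ∨ z i j = true} = 1 := by
          rw [Nat.card_eq_one_iff_exists]
          refine ⟨⟨fun _ _ => true, hA, fun _ _ => Or.inr rfl⟩, fun z => ?_⟩
          ext i j
          simpa [hR] using z.2.2 i j
        exact congrArg (· % 2 ^ N) this
      · obtain ⟨i₀, h₀⟩ := not_forall_not.mp hR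
        rw [if_neg (fun h => hR h.2), Nat.modEq_zero_iff_dvd]
        have card_rows : Nat.card {z : ι → Fin N → Bool // A p ∧ ∀ i j, R p i ∨ z i j = true} =
            ∏ i, Nat.card {r : Fin N → Bool // ∀ j, R p i ∨ r j = true} := by
          rw [← Nat.card_pi]
          exact Nat.card_congr ((Equiv.subtypeEquivRight fun z => and_iff_right hA).trans
            (Equiv.subtypePiEquivPi (p := fun i (r : Fin N → Bool) => ∀ j, R p i ∨ r j = true)))
        have card_row : Nat.card {r : Fin N → Bool // ∀ j, R p i₀ ∨ r j = true} = 2 ^ N := by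
          simp [h₀]
        rw [card_rows, ← card_row]
        exact Finset.dvd_prod_of_mem _ (Finset.mem_univ i₀)
    · simp [hA, Nat.ModEq.refl]
  have card_sigma :
      Nat.card {q : P × (ι → Fin N → Bool) // A q.1 ∧ ∀ i j, R q.1 i ∨ q.2 i j = true} =
        ∑ p, Nat.card {z : ι → Fin N → Bool // A p ∧ ∀ i j, R p i ∨ z i j = true} := by
    rw [← Nat.card_sigma]
    exact Nat.card_congr (Equiv.subtypeProdEquivSigmaSubtype
      fun p (z : ι → Fin N → Bool) => A p ∧ ∀ i j, R p i ∨ z i j = true)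
  have card_good : Nat.card {p : P // A p ∧ ∀ i, ¬ R p i} =
      ∑ p, if A p ∧ ∀ i, ¬ R p i then 1 else 0 := by
    rw [Nat.card_eq_fintype_card, Fintype.card_subtype, Finset.card_filter]
  rw [card_sigma, card_good]
  exact Nat.ModEq.sum fun p _ => fiber p

namespace CNF

theorem count_lt_two_pow_succ {n : ℕ} (φ : CNF n) : φ.count < 2 ^ (n + 1) := by
  have h : φ.count ≤ 2 ^ n := by
    simpa [count] using Finite.card_subtype_le (fun x : Fin n → Bool => φ.Sat x)
  exact h.trans_lt (Nat.pow_lt_pow_right one_lt_two n.lt_succ_self)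

/-- Satisfying assignments correspond to truth values of all literals in which complementary
literals get complementary values. -/
theorem count_eq_card_literal {n : ℕ} (φ : CNF n) :
    φ.count = Nat.card {p : Fin n × Bool → Bool //
      ((∀ c ∈ φ, ∃ l ∈ c, p l = true) ∧ ∀ i, p (i, true) = true ∨ p (i, false) = true) ∧
        ∀ i, ¬ (p (i, true) = true ∧ p (i, false) = true)} := by
  refine Nat.card_congr ⟨fun x => ⟨fun l => x.1 l.1 == l.2, ⟨fun c hc => ?_, fun i => ?_⟩,
    fun i => ?_⟩, fun p => ⟨fun i => p.1 (i, true), fun c hc => ?_⟩, fun x => ?_, fun p => ?_⟩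
  · simpa using x.2 c hc
  · cases x.1 i <;> simp
  · cases x.1 i <;> simp
  · obtain ⟨⟨i, b⟩, hl, hp⟩ := p.2.1.1 c hc
    refine ⟨_, hl, ?_⟩
    have := p.2.2 i
    cases b <;> simp_all
  · ext i
    simp
  · ext ⟨i, b⟩
    have h₁ := p.2.1.2 i
    have h₂ := p.2.2 i
    cases b <;> cases ht : p.1 (i, true) <;> simp_all

/-- The variables of the monotone formula: one for each literal of the original formula, and `N`
further ones for each original variable. -/
abbrev MonotoneVar (n N : ℕ) := (Fin n × Bool) ⊕ (Fin n × Fin N)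

/-- The monotone formula obtained from `φ` by renaming literals to fresh variables, requiring one of
any two complementary literals to hold, and letting the further variables of `i` be free only
if both literals of `i` hold. -/
noncomputable def toMonotone {n n' N : ℕ} (e : MonotoneVar n N ≃ Fin n') (φ : CNF n) : CNF n' :=
  φ.map (Finset.image fun l => (e (.inl l), true)) ++
    (Finset.univ.toList.map fun i : Fin n =>
      {(e (.inl (i, true)), true), (e (.inl (i, false)), true)}) ++
    Finset.univ.toList.map fun q : (Fin n × Bool) × Fin N =>
      {(e (.inl q.1), true), (e (.inr (q.1.1, q.2)), true)}

variable {n n' N : ℕ} (e : MonotoneVar n N ≃ Fin n') (φ : CNF n)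

theorem isKCNF_toMonotone {k : ℕ} (hk : 2 ≤ k) (hφ : φ.IsKCNF k) : (φ.toMonotone e).IsKCNF k := by
  intro c hc
  simp only [toMonotone, List.mem_append, List.mem_map] at hc
  obtain (⟨d, hd, rfl⟩ | ⟨i, -, rfl⟩) | ⟨q, -, rfl⟩ := hc
  · exact Finset.card_image_le.trans (hφ d hd)
  · exact Finset.card_le_two.trans hk
  · exact Finset.card_le_two.trans hk

theorem monotone_toMonotone : (φ.toMonotone e).Monotone' := by
  intro c hc l hl
  simp only [toMonotone, List.mem_append, List.mem_map] at hc
  obtain (⟨d, hd, rfl⟩ | ⟨i, -, rfl⟩) | ⟨q, -, rfl⟩ := hc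
  · obtain ⟨_, -, rfl⟩ := Finset.mem_image.mp hl
    rfl
  · aesop
  · aesop

theorem sat_toMonotone (w : Fin n' → Bool) :
    (φ.toMonotone e).Sat w ↔
      ((∀ c ∈ φ, ∃ l ∈ c, w (e (.inl l)) = true) ∧
        ∀ i, w (e (.inl (i, true))) = true ∨ w (e (.inl (i, false))) = true) ∧
      ∀ i j, (w (e (.inl (i, true))) = true ∧ w (e (.inl (i, false))) = true) ∨
        w (e (.inr (i, j))) = true := by
  simp only [Sat, toMonotone, List.forall_mem_append, List.forall_mem_map, Finset.mem_toList,
    Finset.mem_univ, forall_true_left, Finset.exists_mem_image, Finset.exists_mem_insert,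
    Finset.mem_singleton, exists_eq_left]
  refine and_congr Iff.rfl ⟨fun h i j => ?_, fun h q => ?_⟩
  · have h₁ := h ((i, true), j)
    have h₂ := h ((i, false), j)
    tauto
  · obtain ⟨⟨i, b⟩, j⟩ := q
    have := h i j
    cases b <;> tauto

theorem count_toMonotone : (φ.toMonotone e).count ≡ φ.count [MOD 2 ^ N] := by
  rw [count_eq_card_literal φ]
  refine Nat.ModEq.trans (congrArg (· % 2 ^ N) ?_) (card_forcedBits_modEq (ι := Fin n) N
    (fun p : Fin n × Bool → Bool =>
      (∀ c ∈ φ, ∃ l ∈ c, p l = true) ∧ ∀ i, p (i, true) = true ∨ p (i, false) = true)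
    fun p i => p (i, true) = true ∧ p (i, false) = true)
  let f : (Fin n' → Bool) ≃ (Fin n × Bool → Bool) × (Fin n → Fin N → Bool) :=
    (Equiv.arrowCongr e.symm (Equiv.refl Bool)).trans
      ((Equiv.sumArrowEquivProdArrow _ _ _).trans
        (Equiv.prodCongr (Equiv.refl _) (Equiv.curry _ _ _)))
  exact Nat.card_congr (f.subtypeEquiv fun w => sat_toMonotone e φ w)

end CNF

/-- counting reduction #kSAT → #MON-kSAT (Theorem `sattomonosattheorem`). -/
theorem sat_to_monotoneSat :
    ∃ C : ℕ, ∀ (k : ℕ), 2 ≤ k → ∀ (n m : ℕ) (φ : CNF n), φ.length = m →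
      CNF.IsKCNF k φ →
      ∃ (n' : ℕ) (φ' : CNF n'), n' ≤ C * (n + n * m * (n + 2)) ∧
        CNF.IsKCNF k φ' ∧ CNF.Monotone' φ' ∧
        CNF.count φ = CNF.count φ' % 2 ^ (n + 1) := by
  refine ⟨1, fun k hk n m φ hm hφ => ?_⟩
  obtain rfl | hpos := Nat.eq_zero_or_pos m
  · obtain rfl := List.length_eq_zero_iff.mp hm
    exact ⟨n, [], by simp, hφ, by simp [CNF.Monotone'],
      (Nat.mod_eq_of_lt (CNF.count_lt_two_pow_succ _)).symm⟩
  · let e := Fintype.equivFin (CNF.MonotoneVar n (n + 1))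
    refine ⟨_, φ.toMonotone e, ?_, CNF.isKCNF_toMonotone e φ hk hφ, CNF.monotone_toMonotone e φ, ?_⟩
    · have : n * 1 * (n + 2) ≤ n * m * (n + 2) := by gcongr; exact hpos
      simp only [Fintype.card_sum, Fintype.card_prod, Fintype.card_fin, Fintype.card_bool]
      linarith
    · exact (Nat.mod_eq_of_lt φ.count_lt_two_pow_succ).symm.trans (CNF.count_toMonotone e φ).symm
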